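/- Let G be a mixed lattice group and let S be an A-substructure of G. Then S is naturally ordered with respect to ⪯ (for x, y ∈ S, x ⪯ y iff y = x + w for some w ∈ S), and for all x, y ∈ S the element x ⩖ y (computed in G) belongs to S and is the least element with respect to ≤ of the set {w ∈ S : x ⪯ w and y ≤ w}; consequently S, with the orders restricted from G, is an A-structure in its own right and its mixed upper envelopes agree with those of G. -/

import Mathlib

/-- A commutative monoid equipped with two partial orders (the initial order `le` = `≤`
and the specific order `sle` = `⪯`), each compatible with addition. -/
structure TwoOrders (M : Type*) [AddCommMonoid M] where
  le : M → M → Prop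
  sle : M → M → Prop
  le_refl : ∀ x, le x x
  le_antisymm : ∀ x y, le x y → le y x → x = y
  le_trans : ∀ x y z, le x y → le y z → le x z
  sle_refl : ∀ x, sle x x
  sle_antisymm : ∀ x y, sle x y → sle y x → x = y
  sle_trans : ∀ x y z, sle x y → sle y z → sle x z
  add_le_add : ∀ x y w, le x y → le (x + w) (y + w)
  add_sle_add : ∀ x y w, sle x y → sle (x + w) (y + w)

/-- `w` is the mixed upper envelope `u ⩖ v`, i.e. the least element (w.r.t. `le`) of
`{w : sle u w ∧ le v w}`. -/
def TwoOrders.IsUpperEnv {M : Type*} [AddCommMonoid M] (O : TwoOrders M) (u v w : M) : Prop :=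
  O.sle u w ∧ O.le v w ∧ ∀ z, O.sle u z → O.le v z → O.le w z

/-- `w` is the mixed lower envelope `u ⩗ v`, i.e. the greatest element (w.r.t. `le`) of
`{w : sle w u ∧ le w v}`. -/
def TwoOrders.IsLowerEnv {M : Type*} [AddCommMonoid M] (O : TwoOrders M) (u v w : M) : Prop :=
  O.sle w u ∧ O.le w v ∧ ∀ z, O.sle z u → O.le z v → O.le z w

/-- An A-structure: naturally ordered w.r.t. `sle`, strong cancellation for `le`,
and all mixed upper envelopes exist. -/
def TwoOrders.IsAStructure {M : Type*} [AddCommMonoid M] (O : TwoOrders M) : Prop :=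
  (∀ u v, O.sle u v ↔ ∃ w, v = u + w) ∧
  (∀ u v w, O.le u v ↔ O.le (u + w) (v + w)) ∧
  (∀ u v, ∃ w, O.IsUpperEnv u v w)

/-- A B-structure: naturally ordered w.r.t. `le`, strong cancellation for `sle`,
and all mixed upper envelopes exist. -/
def TwoOrders.IsBStructure {M : Type*} [AddCommMonoid M] (O : TwoOrders M) : Prop :=
  (∀ u v, O.le u v ↔ ∃ w, v = u + w) ∧
  (∀ u v w, O.sle u v ↔ O.sle (u + w) (v + w)) ∧
  (∀ u v, ∃ w, O.IsUpperEnv u v w)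

/-- A mixed lattice group: all mixed upper and lower envelopes exist. -/
def TwoOrders.IsMLG {M : Type*} [AddCommMonoid M] (O : TwoOrders M) : Prop :=
  (∀ u v, ∃ w, O.IsUpperEnv u v w) ∧ (∀ u v, ∃ w, O.IsLowerEnv u v w)

theorem Asubstructure_is_Astructure {G : Type*} [AddCommGroup G]
    (O : TwoOrders G) (hMLG : O.IsMLG)
    (S : Set G) (h0 : (0 : G) ∈ S) (hadd : ∀ x ∈ S, ∀ y ∈ S, x + y ∈ S)
    (hsp : ∀ x ∈ S, O.sle 0 x)
    (hA : ∀ x ∈ S, ∀ y ∈ S, ∀ e, O.IsUpperEnv x y e → e - x ∈ S) :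
    (∀ x ∈ S, ∀ y ∈ S, (O.sle x y ↔ ∃ w ∈ S, y = x + w)) ∧
    (∀ x ∈ S, ∀ y ∈ S, ∀ e, O.IsUpperEnv x y e →
      e ∈ S ∧ O.sle x e ∧ O.le y e ∧ ∀ z ∈ S, O.sle x z → O.le y z → O.le e z) := by
  refine ⟨fun x hx y hy => ⟨fun h => ?_, ?_⟩, fun x hx y hy e he => ?_⟩
  · exact ⟨y - x, hA x hx y hy y ⟨h, O.le_refl y, fun _ _ hz => hz⟩, (add_sub_cancel x y).symm⟩
  · rintro ⟨w, hw, rfl⟩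
    simpa [add_comm] using O.add_sle_add 0 w x (hsp w hw)
  · refine ⟨?_, he.1, he.2.1, fun z _ => he.2.2 z⟩
    simpa using hadd x hx _ (hA x hx y hy e he)
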